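/- arXiv:1705.02134 — 2 statements merged into one kernel-verified Lean document; each statement's English description precedes it below -/
import Mathlib

section
/- Let N ≡ 3 (mod 4) be a positive integer, α = (−1 + i√N)/2, and H₃ = [[0,0,1],[0,1,0],[1,0,0]], with U(H₃) = {g ∈ GL(3,ℂ) : g^†H₃g = H₃}. Let 𝕃₂ = {(z₀,z₁) ∈ ℂ² : 2·Re(z₀) + |z₁|² < 0}, and for (z₀,z₁) ∈ 𝕃₂ define ρ_*(z₀,z₁) = (2z₀ + z₁²)^{−1} · [[−i√N·z₀², −i√N·z₀z₁, −z₀ + αz₁²], [−i√N·z₁z₀, 2αz₀ + ᾱz₁², −i√N·z₁], [−z₀ + αz₁², −i√N·z₁, −i√N]]. Then: (i) 2z₀ + z₁² ≠ 0 on 𝕃₂; (ii) ρ_*(z₀,z₁) is a symmetric 3×3 complex matrix whose imaginary part is positive definite (i.e. ρ_*(z₀,z₁) lies in the Siegel space 𝕊₃); and (iii) for every g = (g_{kl}) ∈ U(H₃), writing the standard embedding ρ(g) = [[A,B],[C,D]] in 3×3 blocks, the matrix C·ρ_*(z₀,z₁) + D is invertible, g₃₁z₀ + g₃₂z₁ +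 g₃₃ ≠ 0, and (A·ρ_*(z₀,z₁) + B)·(C·ρ_*(z₀,z₁) + D)^{−1} = ρ_*(g·(z₀,z₁)), where g·(z₀,z₁) = ((g₁₁z₀ + g₁₂z₁ + g₁₃)/(g₃₁z₀ + g₃₂z₁ + g₃₃), (g₂₁z₀ + g₂₂z₁ + g₂₃)/(g₃₁z₀ + g₃₂z₁ + g₃₃)) again lies in 𝕃₂. -/
noncomputable section

open Matrix

/-- `i√N`, the principal square root of `−N`. -/
def sqN (N : ℕ) : ℂ := Complex.I * (Real.sqrt N : ℂ)

/-- `α = (−1 + i√N)/2`. -/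
def alphaN (N : ℕ) : ℂ := (-1 + sqN N) / 2

/-- `ᾱ = (−1 − i√N)/2`. -/
def alphaBarN (N : ℕ) : ℂ := (-1 - sqN N) / 2

/-- The hermitian form `H₃` of signature `(2,1)`, as a complex matrix. -/
def H3c : Matrix (Fin 3) (Fin 3) ℂ := !![0, 0, 1; 0, 1, 0; 1, 0, 0]

/-- The hermitian form `H₃`, as a real matrix. -/
def H3r : Matrix (Fin 3) (Fin 3) ℝ := !![0, 0, 1; 0, 1, 0; 1, 0, 0]

/-- Membership in the left half-space `𝕃₂`: `2·Re(z₀) + |z₁|² < 0`. -/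
def InL2 (z₀ z₁ : ℂ) : Prop := 2 * z₀.re + Complex.normSq z₁ < 0

/-- The matrix `ρ_*(z₀,z₁) ∈ 𝕊₃`. -/
def rhoStar (N : ℕ) (z₀ z₁ : ℂ) : Matrix (Fin 3) (Fin 3) ℂ :=
  (2 * z₀ + z₁ ^ 2)⁻¹ •
    !![-(sqN N) * z₀ ^ 2, -(sqN N) * z₀ * z₁, -z₀ + alphaN N * z₁ ^ 2;
       -(sqN N) * z₁ * z₀, 2 * alphaN N * z₀ + alphaBarN N * z₁ ^ 2, -(sqN N) * z₁;
       -z₀ + alphaN N * z₁ ^ 2, -(sqN N) * z₁, -(sqN N)]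

/-- The real matrix `Y` with `g = X + αY`, namely `Y = (2/√N)·Im(g)`. -/
def Yof (N : ℕ) (g : Matrix (Fin 3) (Fin 3) ℂ) : Matrix (Fin 3) (Fin 3) ℝ :=
  (2 / Real.sqrt N) • g.map Complex.im

/-- The real matrix `X` with `g = X + αY`, namely `X = Re(g) + Y/2`. -/
def Xof (N : ℕ) (g : Matrix (Fin 3) (Fin 3) ℂ) : Matrix (Fin 3) (Fin 3) ℝ :=
  g.map Complex.re + ((1 : ℝ) / 2) • Yof N g

/-- The block `A` of the standard embedding `ρ(g) = [[A,B],[C,D]]`. -/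
def Ablk (N : ℕ) (g : Matrix (Fin 3) (Fin 3) ℂ) : Matrix (Fin 3) (Fin 3) ℝ := Xof N g

/-- The block `B` of the standard embedding. -/
def Bblk (N : ℕ) (g : Matrix (Fin 3) (Fin 3) ℂ) : Matrix (Fin 3) (Fin 3) ℝ :=
  (((N : ℝ) + 1) / 4) • (Yof N g * H3r)

/-- The block `C` of the standard embedding. -/
def Cblk (N : ℕ) (g : Matrix (Fin 3) (Fin 3) ℂ) : Matrix (Fin 3) (Fin 3) ℝ :=
  -(H3r * Yof N g)

/-- The block `D` of the standard embedding. -/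
def Dblk (N : ℕ) (g : Matrix (Fin 3) (Fin 3) ℂ) : Matrix (Fin 3) (Fin 3) ℝ :=
  H3r * (Xof N g - Yof N g) * H3r

/-- The fractional linear action of `U(H₃)` on `𝕃₂` (first coordinate). -/
def act0 (g : Matrix (Fin 3) (Fin 3) ℂ) (z₀ z₁ : ℂ) : ℂ :=
  (g 0 0 * z₀ + g 0 1 * z₁ + g 0 2) / (g 2 0 * z₀ + g 2 1 * z₁ + g 2 2)

/-- The fractional linear action of `U(H₃)` on `𝕃₂` (second coordinate). -/
def act1 (g : Matrix (Fin 3) (Fin 3) ℂ) (z₀ z₁ : ℂ) : ℂ :=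
  (g 1 0 * z₀ + g 1 1 * z₁ + g 1 2) / (g 2 0 * z₀ + g 2 1 * z₁ + g 2 2)

theorem two_mul_add_sq_ne_zero_of_inL2 {z₀ z₁ : ℂ} (hz : InL2 z₀ z₁) :
    2 * z₀ + z₁ ^ 2 ≠ 0 := by
  intro h
  have h' := congrArg Complex.re h
  simp only [InL2, Complex.normSq_apply] at hz
  simp [pow_two] at h'
  nlinarith [mul_self_nonneg z₁.im]

theorem sqN_mul_self (N : ℕ) : sqN N * sqN N = -(N : ℂ) := by
  have h : ((Real.sqrt N : ℝ) : ℂ) * (Real.sqrt N : ℝ) = N := by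
    rw [← Complex.ofReal_mul, Real.mul_self_sqrt (Nat.cast_nonneg N), Complex.ofReal_natCast]
  rw [sqN]
  linear_combination (Complex.I * Complex.I) * h + (N : ℂ) * Complex.I_mul_I

/-- The homogeneous coordinates of a point of `ℂ²`. -/
def homCoord (z₀ z₁ : ℂ) : Fin 3 → ℂ := ![z₀, z₁, 1]

theorem rhoStar_eq (N : ℕ) {z₀ z₁ : ℂ} (hs : 2 * z₀ + z₁ ^ 2 ≠ 0) :
    rhoStar N z₀ z₁ = alphaN N • H3c -
      (sqN N / (2 * z₀ + z₁ ^ 2)) • vecMulVec (homCoord z₀ z₁) (homCoord z₀ z₁) := by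
  ext i j
  fin_cases i <;> fin_cases j <;>
    simp [rhoStar, H3c, homCoord, alphaN, alphaBarN] <;> field_simp <;> ring

theorem rhoStar_transpose (N : ℕ) (z₀ z₁ : ℂ) : (rhoStar N z₀ z₁)ᵀ = rhoStar N z₀ z₁ := by
  ext i j
  fin_cases i <;> fin_cases j <;> simp [rhoStar, mul_right_comm]

theorem hermForm_sub_re_pos {z₀ z₁ : ℂ} (hz : InL2 z₀ z₁) {x : Fin 3 → ℝ} (hx : x ≠ 0) :
    0 < 2 * x 0 * x 2 + x 1 ^ 2 -
      2 * ((z₀ * x 0 + z₁ * x 1 + x 2) ^ 2 / (2 * z₀ + z₁ ^ 2)).re := by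
  have hs := two_mul_add_sq_ne_zero_of_inL2 hz
  obtain ⟨t, ht⟩ : ∃ t, t = (z₀ * x 0 + z₁ * x 1 + x 2) / (2 * z₀ + z₁ ^ 2) := ⟨_, rfl⟩
  have hst : (2 * z₀ + z₁ ^ 2) * t = z₀ * x 0 + z₁ * x 1 + x 2 := by
    rw [ht]; field_simp
  have hq : (z₀ * x 0 + z₁ * x 1 + x 2) ^ 2 / (2 * z₀ + z₁ ^ 2)
      = (z₀ * x 0 + z₁ * x 1 + x 2) * t := by
    rw [ht]; ring
  have key : 2 * x 0 * x 2 + x 1 ^ 2 - 2 * ((z₀ * x 0 + z₁ * x 1 + x 2) * t).re =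
      Complex.normSq (x 1 - t * z₁ - (starRingEnd ℂ) z₁ * (x 0 - t)) -
        (2 * z₀.re + Complex.normSq z₁) * (Complex.normSq (x 0 - t) + Complex.normSq t) := by
    have hre := congrArg Complex.re hst
    have him := congrArg Complex.im hst
    simp [Complex.normSq_apply, pow_two] at hre him ⊢
    linear_combination 2 * t.im * him - (2 * (x 0 - t.re)) * hre
  rw [hq, key]
  have h0 : 0 < -(2 * z₀.re + Complex.normSq z₁) := neg_pos.2 hz
  have h1 := Complex.normSq_nonneg (x 1 - t * z₁ - (starRingEnd ℂ) z₁ * (x 0 - t))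
  have h2 := Complex.normSq_nonneg (x 0 - t)
  have h3 := Complex.normSq_nonneg t
  by_contra! hle
  have h23 : Complex.normSq (x 0 - t) + Complex.normSq t = 0 := by nlinarith
  have ht0 : t = 0 := Complex.normSq_eq_zero.1 (by linarith)
  have hx0 : x 0 = 0 := by
    simpa [ht0] using Complex.normSq_eq_zero.1 (show Complex.normSq (x 0 - t) = 0 by linarith)
  have hx1 : x 1 = 0 := by
    have : Complex.normSq (x 1 - t * z₁ - (starRingEnd ℂ) z₁ * (x 0 - t)) = 0 := by nlinarith
    simpa [ht0, hx0] using this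
  have hx2 : x 2 = 0 := by
    have h : (0 : ℂ) = x 2 := by simpa [ht0, hx0, hx1] using hst
    exact_mod_cast h.symm
  exact hx (by ext i; fin_cases i <;> simp [hx0, hx1, hx2])

theorem rhoStar_im_posDef {N : ℕ} (hN : 0 < N) {z₀ z₁ : ℂ} (hz : InL2 z₀ z₁) :
    ((rhoStar N z₀ z₁).map Complex.im).PosDef := by
  have hs := two_mul_add_sq_ne_zero_of_inL2 hz
  refine Matrix.PosDef.of_dotProduct_mulVec_pos ?_ fun x hx => ?_
  · rw [Matrix.IsHermitian, conjTranspose_eq_transpose_of_trivial, ← transpose_map,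
      rhoStar_transpose]
  · have h := mul_pos (Real.sqrt_pos.2 (Nat.cast_pos.2 hN)) (hermForm_sub_re_pos hz hx)
    have hx' : star x ⬝ᵥ (rhoStar N z₀ z₁).map Complex.im *ᵥ x =
        Real.sqrt N / 2 * (2 * x 0 * x 2 + x 1 ^ 2 -
          2 * ((z₀ * x 0 + z₁ * x 1 + x 2) ^ 2 / (2 * z₀ + z₁ ^ 2)).re) := by
      rw [rhoStar_eq N hs]
      generalize 2 * z₀ + z₁ ^ 2 = s
      simp only [div_eq_mul_inv _ s]
      generalize s⁻¹ = r
      simp only [dotProduct, mulVec, Fin.sum_univ_three, map_apply, Matrix.sub_apply,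
        Matrix.smul_apply, vecMulVec_apply]
      simp [H3c, homCoord, alphaN, sqN, pow_two]
      ring
    rw [hx']
    linarith

theorem star_dotProduct_H3c_mulVec (w : Fin 3 → ℂ) :
    (star w ⬝ᵥ H3c *ᵥ w).re = 2 * (w 0 * star (w 2)).re + Complex.normSq (w 1) := by
  simp [dotProduct, mulVec, Fin.sum_univ_three, H3c, Complex.normSq_apply]
  ring

theorem homCoord_dotProduct_H3c_mulVec (z₀ z₁ : ℂ) :
    homCoord z₀ z₁ ⬝ᵥ H3c *ᵥ homCoord z₀ z₁ = 2 * z₀ + z₁ ^ 2 := by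
  simp [dotProduct, mulVec, Fin.sum_univ_three, H3c, homCoord]
  ring

theorem H3c_mul_self : H3c * H3c = 1 := by
  ext i j
  fin_cases i <;> fin_cases j <;> simp [H3c, Matrix.mul_apply, Fin.sum_univ_three]

theorem H3c_transpose : H3cᵀ = H3c := by
  ext i j
  fin_cases i <;> fin_cases j <;> simp [H3c]

theorem H3r_map : H3r.map Complex.ofReal = H3c := by
  ext i j
  fin_cases i <;> fin_cases j <;> simp [H3c, H3r]

section Unitary

variable {g : Matrix (Fin 3) (Fin 3) ℂ} {z₀ z₁ : ℂ}

theorem mulVec_homCoord_form_neg (hg : gᴴ * H3c * g = H3c) (hz : InL2 z₀ z₁) :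
    2 * ((g *ᵥ homCoord z₀ z₁) 0 * star ((g *ᵥ homCoord z₀ z₁) 2)).re +
      Complex.normSq ((g *ᵥ homCoord z₀ z₁) 1) < 0 := by
  rw [← star_dotProduct_H3c_mulVec, star_mulVec, ← dotProduct_mulVec, mulVec_mulVec,
    mulVec_mulVec, hg, star_dotProduct_H3c_mulVec]
  simpa [homCoord, InL2] using hz

theorem mulVec_homCoord_apply (i : Fin 3) :
    (g *ᵥ homCoord z₀ z₁) i = g i 0 * z₀ + g i 1 * z₁ + g i 2 := by
  simp [mulVec, dotProduct, Fin.sum_univ_three, homCoord]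

theorem denom_ne_zero (hg : gᴴ * H3c * g = H3c) (hz : InL2 z₀ z₁) :
    g 2 0 * z₀ + g 2 1 * z₁ + g 2 2 ≠ 0 := by
  intro h
  have h' := mulVec_homCoord_form_neg hg hz
  rw [mulVec_homCoord_apply 2, h] at h'
  simp only [star_zero, mul_zero, Complex.zero_re, zero_add] at h'
  exact absurd (Complex.normSq_nonneg _) h'.not_ge

theorem mulVec_homCoord (hj : g 2 0 * z₀ + g 2 1 * z₁ + g 2 2 ≠ 0) :
    g *ᵥ homCoord z₀ z₁ =
      (g 2 0 * z₀ + g 2 1 * z₁ + g 2 2) • homCoord (act0 g z₀ z₁) (act1 g z₀ z₁) := by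
  ext i
  rw [mulVec_homCoord_apply]
  fin_cases i <;> simp [homCoord, act0, act1, mul_div_cancel₀, hj]

theorem inL2_act (hg : gᴴ * H3c * g = H3c) (hz : InL2 z₀ z₁) :
    InL2 (act0 g z₀ z₁) (act1 g z₀ z₁) := by
  have hj := denom_ne_zero hg hz
  have h := mulVec_homCoord_form_neg hg hz
  rw [mulVec_homCoord hj] at h
  generalize g 2 0 * z₀ + g 2 1 * z₁ + g 2 2 = j at h hj
  have hj' := Complex.normSq_pos.2 hj
  have e : 2 * ((j • homCoord (act0 g z₀ z₁) (act1 g z₀ z₁)) 0 *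
      star ((j • homCoord (act0 g z₀ z₁) (act1 g z₀ z₁)) 2)).re +
      Complex.normSq ((j • homCoord (act0 g z₀ z₁) (act1 g z₀ z₁)) 1) =
      Complex.normSq j * (2 * (act0 g z₀ z₁).re + Complex.normSq (act1 g z₀ z₁)) := by
    simp [homCoord, Complex.normSq_apply]
    ring
  rw [e] at h
  exact neg_of_mul_neg_right h hj'.le

theorem transpose_mul_H3c_mul_map_star (hg : gᴴ * H3c * g = H3c) :
    gᵀ * H3c * g.map star = H3c := by
  have h := congrArg transpose hg
  rw [transpose_mul, transpose_mul, H3c_transpose, ← Matrix.mul_assoc] at h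
  exact h

theorem isUnit_map_star (hg : gᴴ * H3c * g = H3c) : IsUnit (g.map star) := by
  have h : (H3c * gᵀ * H3c) * g.map star = 1 := by
    rw [Matrix.mul_assoc, Matrix.mul_assoc, ← Matrix.mul_assoc gᵀ,
      transpose_mul_H3c_mul_map_star hg, H3c_mul_self]
  exact (Matrix.isUnit_iff_isUnit_det _).2 (Matrix.isUnit_det_of_left_inverse h)

theorem Yof_map {N : ℕ} (hN : 0 < N) :
    sqN N • (Yof N g).map Complex.ofReal = g - g.map star := by
  have h : ((Real.sqrt N : ℝ) : ℂ) ≠ 0 := by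
    exact_mod_cast (Real.sqrt_pos.2 (Nat.cast_pos.2 hN)).ne'
  ext i j
  simp only [sqN, Yof, Matrix.smul_apply, map_apply, Matrix.sub_apply, smul_eq_mul,
    Complex.ofReal_mul, Complex.ofReal_div, Complex.ofReal_ofNat, Complex.star_def,
    Complex.sub_conj]
  field_simp

theorem Xof_map {N : ℕ} (hN : 0 < N) :
    (Xof N g).map Complex.ofReal = g - alphaN N • (Yof N g).map Complex.ofReal := by
  ext i j
  have h := congrFun (congrFun (Yof_map (g := g) hN) i) j
  have hre := Complex.re_eq_add_conj (g i j)
  simp only [Matrix.smul_apply, map_apply, Matrix.sub_apply, smul_eq_mul, Complex.star_def] at h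
  simp only [Xof, alphaN, Matrix.smul_apply, map_apply, Matrix.sub_apply, Matrix.add_apply, smul_eq_mul,
    Complex.ofReal_add, Complex.ofReal_mul, Complex.ofReal_div, Complex.ofReal_one,
    Complex.ofReal_ofNat]
  linear_combination hre + h / 2

theorem map_star_eq {N : ℕ} (hN : 0 < N) :
    g.map star = g - (2 * alphaN N + 1) • (Yof N g).map Complex.ofReal := by
  have h : 2 * alphaN N + 1 = sqN N := by rw [alphaN]; ring
  rw [h, Yof_map hN, sub_sub_cancel]

theorem Cblk_mul_rhoStar_add_Dblk {N : ℕ} (hN : 0 < N) (hs : 2 * z₀ + z₁ ^ 2 ≠ 0) :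
    (Cblk N g).map Complex.ofReal * rhoStar N z₀ z₁ + (Dblk N g).map Complex.ofReal =
      H3c * (g.map star * H3c + (sqN N / (2 * z₀ + z₁ ^ 2)) •
        ((Yof N g).map Complex.ofReal * vecMulVec (homCoord z₀ z₁) (homCoord z₀ z₁))) := by
  have hC : (Cblk N g).map Complex.ofReal = -(H3c * (Yof N g).map Complex.ofReal) := by
    rw [Cblk, Matrix.map_neg _ Complex.ofReal_neg, ← H3r_map]
    congr 1
    exact Matrix.map_mul (f := Complex.ofRealHom)
  have hD : (Dblk N g).map Complex.ofReal =
      H3c * ((Xof N g).map Complex.ofReal - (Yof N g).map Complex.ofReal) * H3c := by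
    rw [Dblk, ← Matrix.map_sub _ Complex.ofReal_sub, ← H3r_map]
    exact (Matrix.map_mul (f := Complex.ofRealHom)).trans
      (congrArg (· * _) (Matrix.map_mul (f := Complex.ofRealHom)))
  rw [hC, hD, rhoStar_eq N hs, Xof_map hN, map_star_eq hN]
  simp only [Matrix.mul_sub, Matrix.sub_mul, Matrix.mul_add, Matrix.neg_mul, Matrix.mul_smul,
    Matrix.smul_mul, Matrix.mul_assoc]
  module

theorem Ablk_mul_rhoStar_add_Bblk {N : ℕ} (hN : 0 < N) (hs : 2 * z₀ + z₁ ^ 2 ≠ 0) :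
    (Ablk N g).map Complex.ofReal * rhoStar N z₀ z₁ + (Bblk N g).map Complex.ofReal =
      alphaN N • (g.map star * H3c + (sqN N / (2 * z₀ + z₁ ^ 2)) •
        ((Yof N g).map Complex.ofReal * vecMulVec (homCoord z₀ z₁) (homCoord z₀ z₁))) -
      (sqN N / (2 * z₀ + z₁ ^ 2)) • (g * vecMulVec (homCoord z₀ z₁) (homCoord z₀ z₁)) := by
  have hα : ((((N : ℝ) + 1) / 4 : ℝ) : ℂ) = -alphaN N - alphaN N ^ 2 := by
    have := sqN_mul_self N
    push_cast
    rw [alphaN]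
    linear_combination this / 4
  have hB : (Bblk N g).map Complex.ofReal =
      (-alphaN N - alphaN N ^ 2) • ((Yof N g).map Complex.ofReal * H3c) := by
    rw [← hα, ← H3r_map, Bblk]
    have : ((Yof N g) * H3r).map Complex.ofReal =
        (Yof N g).map Complex.ofReal * H3r.map Complex.ofReal :=
      Matrix.map_mul (f := Complex.ofRealHom)
    rw [← this]
    ext i j
    simp
  rw [hB, Ablk, rhoStar_eq N hs, Xof_map hN, map_star_eq hN]
  simp only [Matrix.mul_sub, Matrix.sub_mul, Matrix.mul_smul, Matrix.smul_mul]
  module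

theorem homCoord_act_vecMul {N : ℕ} (hN : 0 < N) (hg : gᴴ * H3c * g = H3c)
    (hs : 2 * z₀ + z₁ ^ 2 ≠ 0) (hj : g 2 0 * z₀ + g 2 1 * z₁ + g 2 2 ≠ 0) :
    homCoord (act0 g z₀ z₁) (act1 g z₀ z₁) ᵥ*
      ((Cblk N g).map Complex.ofReal * rhoStar N z₀ z₁ + (Dblk N g).map Complex.ofReal) =
      ((g 2 0 * z₀ + g 2 1 * z₁ + g 2 2) *
        (2 * act0 g z₀ z₁ + act1 g z₀ z₁ ^ 2) / (2 * z₀ + z₁ ^ 2)) • homCoord z₀ z₁ := by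
  have hv := mulVec_homCoord hj
  rw [Cblk_mul_rhoStar_add_Dblk hN hs, div_eq_mul_inv, mul_comm (sqN N), mul_smul,
    ← Matrix.smul_mul, Yof_map hN]
  have hs' := homCoord_dotProduct_H3c_mulVec (act0 g z₀ z₁) (act1 g z₀ z₁)
  have hs0 := homCoord_dotProduct_H3c_mulVec z₀ z₁
  generalize g 2 0 * z₀ + g 2 1 * z₁ + g 2 2 = j at hv hj ⊢
  generalize homCoord (act0 g z₀ z₁) (act1 g z₀ z₁) = v' at hv hs' ⊢
  generalize homCoord z₀ z₁ = v at hv hs0 ⊢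
  have hvH : j • ((v' ᵥ* H3c) ᵥ* g.map star) = v ᵥ* H3c := by
    rw [← smul_vecMul, ← smul_vecMul, ← hv, ← vecMul_transpose, vecMul_vecMul, vecMul_vecMul,
      ← Matrix.mul_assoc, transpose_mul_H3c_mul_map_star hg]
  have hd : j * ((v' ᵥ* H3c) ⬝ᵥ (g.map star *ᵥ v)) = 2 * z₀ + z₁ ^ 2 := by
    rw [dotProduct_mulVec, ← smul_eq_mul, ← smul_dotProduct, hvH, ← dotProduct_mulVec, hs0]
  have hd' : (v' ᵥ* H3c) ⬝ᵥ (g *ᵥ v) = j * (2 * act0 g z₀ z₁ + act1 g z₀ z₁ ^ 2) := by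
    rw [hv, dotProduct_smul, ← dotProduct_mulVec, hs', smul_eq_mul]
  have hvHH : j • (((v' ᵥ* H3c) ᵥ* g.map star) ᵥ* H3c) = v := by
    rw [← smul_vecMul, hvH, vecMul_vecMul, H3c_mul_self, vecMul_one]
  have hv0 : ((v' ᵥ* H3c) ᵥ* g.map star) ᵥ* H3c = j⁻¹ • v := by
    exact ((inv_smul_eq_iff₀ hj).2 hvHH.symm).symm
  rw [← vecMul_vecMul, vecMul_add, ← vecMul_vecMul, hv0, vecMul_smul, mul_vecMulVec,
    vecMul_vecMulVec, sub_mulVec, dotProduct_sub, hd', smul_smul, ← add_smul]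
  congr 1
  field_simp
  linear_combination -hd

theorem isUnit_Cblk_mul_rhoStar_add_Dblk {N : ℕ} (hN : 0 < N) (hg : gᴴ * H3c * g = H3c)
    (hz : InL2 z₀ z₁) :
    IsUnit ((Cblk N g).map Complex.ofReal * rhoStar N z₀ z₁ +
      (Dblk N g).map Complex.ofReal) := by
  have hs := two_mul_add_sq_ne_zero_of_inL2 hz
  have hs' := two_mul_add_sq_ne_zero_of_inL2 (inL2_act hg hz)
  have hj := denom_ne_zero hg hz
  have hH : IsUnit H3c := IsUnit.of_mul_eq_one _ H3c_mul_self
  rw [← Matrix.mulVec_injective_iff_isUnit]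
  refine (injective_iff_map_eq_zero (Matrix.mulVecLin _)).2 fun u hu => ?_
  rw [Matrix.mulVecLin_apply] at hu
  have h := congrArg (homCoord (act0 g z₀ z₁) (act1 g z₀ z₁) ⬝ᵥ ·) hu
  simp only [dotProduct_mulVec, homCoord_act_vecMul hN hg hs hj, dotProduct_zero,
    smul_dotProduct, smul_eq_mul, mul_eq_zero, div_eq_zero_iff, hs, hs', hj, or_self,
    false_or] at h
  rw [Cblk_mul_rhoStar_add_Dblk hN hs, ← mulVec_mulVec, add_mulVec, smul_mulVec,
    ← mulVec_mulVec, ← mulVec_mulVec _ _ (vecMulVec _ _), vecMulVec_mulVec, h] at hu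
  simp only [MulOpposite.op_zero, zero_smul, mulVec_zero, smul_zero, add_zero,
    mulVec_mulVec] at hu
  have hU := hH.mul ((isUnit_map_star hg).mul hH)
  exact Matrix.mulVec_injective_of_isUnit hU (hu.trans (mulVec_zero _).symm)

theorem rhoStar_act_mul {N : ℕ} (hN : 0 < N) (hg : gᴴ * H3c * g = H3c) (hz : InL2 z₀ z₁) :
    rhoStar N (act0 g z₀ z₁) (act1 g z₀ z₁) *
      ((Cblk N g).map Complex.ofReal * rhoStar N z₀ z₁ + (Dblk N g).map Complex.ofReal) =
      (Ablk N g).map Complex.ofReal * rhoStar N z₀ z₁ + (Bblk N g).map Complex.ofReal := by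
  have hs := two_mul_add_sq_ne_zero_of_inL2 hz
  have hs' := two_mul_add_sq_ne_zero_of_inL2 (inL2_act hg hz)
  have hj := denom_ne_zero hg hz
  rw [rhoStar_eq N hs', Matrix.sub_mul, Matrix.smul_mul, Matrix.smul_mul, vecMulVec_mul,
    homCoord_act_vecMul hN hg hs hj, Ablk_mul_rhoStar_add_Bblk hN hs,
    Cblk_mul_rhoStar_add_Dblk hN hs, ← Matrix.mul_assoc, H3c_mul_self, Matrix.one_mul,
    mul_vecMulVec g, mulVec_homCoord hj, vecMulVec_smul, smul_vecMulVec, smul_smul, smul_smul]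
  congr 2
  field_simp

end Unitary

/-- The map `ρ_* : 𝕃₂ → 𝕊₃` is well defined and equivariant for the standard embedding
`ρ : U(H₃) → Sp(3,ℝ)` and the fractional linear actions. -/
theorem statement12
    (N : ℕ) (hN : N % 4 = 3)
    (z₀ z₁ : ℂ) (hz : InL2 z₀ z₁) :
    2 * z₀ + z₁ ^ 2 ≠ 0 ∧
    (rhoStar N z₀ z₁)ᵀ = rhoStar N z₀ z₁ ∧
    ((rhoStar N z₀ z₁).map Complex.im).PosDef ∧
    (∀ g : Matrix (Fin 3) (Fin 3) ℂ, gᴴ * H3c * g = H3c →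
      IsUnit ((Cblk N g).map (Complex.ofReal) * rhoStar N z₀ z₁
          + (Dblk N g).map (Complex.ofReal)) ∧
      g 2 0 * z₀ + g 2 1 * z₁ + g 2 2 ≠ 0 ∧
      InL2 (act0 g z₀ z₁) (act1 g z₀ z₁) ∧
      ((Ablk N g).map (Complex.ofReal) * rhoStar N z₀ z₁
          + (Bblk N g).map (Complex.ofReal)) *
        ((Cblk N g).map (Complex.ofReal) * rhoStar N z₀ z₁
          + (Dblk N g).map (Complex.ofReal))⁻¹
        = rhoStar N (act0 g z₀ z₁) (act1 g z₀ z₁)) := by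
  have hN0 : 0 < N := by omega
  refine ⟨two_mul_add_sq_ne_zero_of_inL2 hz, rhoStar_transpose N z₀ z₁, rhoStar_im_posDef hN0 hz,
    fun g hg => ?_⟩
  have hU := isUnit_Cblk_mul_rhoStar_add_Dblk hN0 hg hz
  refine ⟨hU, denom_ne_zero hg hz, inL2_act hg hz, ?_⟩
  rw [← rhoStar_act_mul hN0 hg hz,
    Matrix.mul_nonsing_inv_cancel_right _ _ ((Matrix.isUnit_iff_isUnit_det _).1 hU)]
end
end

section
/- Let N ≡ 3 (mod 4) be a positive integer, α = (−1 + i√N)/2, H₃ = [[0,0,1],[0,1,0],[1,0,0]], and U(H₃) = {g ∈ GL(3,ℂ) : g^†H₃g = H₃}. For (z₀,z₁) ∈ 𝕃₂ = {(z₀,z₁) ∈ ℂ² : 2·Re(z₀) + |z₁|² < 0} let Ω = ι_*(z₀,z₁) be the 3×3 matrix [[(((N+1)/2)z₀ + α²z₁²)/(i√N), −αz₁, (z₀ − αz₁²)/(i√N)], [−αz₁, α, z₁], [(z₀ − αz₁²)/(i√N), z₁, (2z₀ + z₁²)/(i√N)]], and let E = (−α, 0, 1)ᵀ. Then for every g =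 (g_{kl}) ∈ U(H₃), writing the twisted embedding ι(g) = t·ρ(g)·t^{−1} = [[A,B],[C,D]] in 3×3 blocks, one has the eigenvector identity (C·Ω + D)ᵀ·E = (g₃₁z₀ + g₃₂z₁ + g₃₃)·E. In particular the line spanned by E is invariant, so the relative tangent bundle of the associated family of abelian three-folds over 𝕃₂ splits off a line bundle. -/
noncomputable section

open Matrix

/-- The standard embedding `ρ(X + αY) = [[X, ((N+1)/4)·YH₃], [−H₃Y, H₃(X−Y)H₃]]`. -/
def rho (N : ℕ) (g : Matrix (Fin 3) (Fin 3) ℂ) :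
    Matrix (Fin 3 ⊕ Fin 3) (Fin 3 ⊕ Fin 3) ℝ :=
  Matrix.fromBlocks (Xof N g) ((((N : ℝ) + 1) / 4) • (Yof N g * H3r))
    (-(H3r * Yof N g)) (H3r * (Xof N g - Yof N g) * H3r)

/-- The twisting matrix `t ∈ Sp(3,ℤ)`, with rows `(1,0,0,0,0,0)`, `(0,1,0,0,0,0)`,
`(0,0,0,0,0,−1)`, `(0,0,0,1,0,0)`, `(0,0,0,0,1,0)`, `(0,0,1,0,0,0)`. -/
def twistT : Matrix (Fin 3 ⊕ Fin 3) (Fin 3 ⊕ Fin 3) ℝ :=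
  Matrix.fromBlocks !![1, 0, 0; 0, 1, 0; 0, 0, 0] !![0, 0, 0; 0, 0, 0; 0, 0, -1]
    !![0, 0, 0; 0, 0, 0; 0, 0, 1] !![1, 0, 0; 0, 1, 0; 0, 0, 0]

/-- The twisted embedding `ι(g) = t·ρ(g)·t⁻¹`. -/
def iota (N : ℕ) (g : Matrix (Fin 3) (Fin 3) ℂ) :
    Matrix (Fin 3 ⊕ Fin 3) (Fin 3 ⊕ Fin 3) ℝ :=
  twistT * rho N g * twistT⁻¹

/-- The period matrix `Ω = ι_*(z₀,z₁) ∈ 𝕊₃` of the twisted embedding. -/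
def iotaStar (N : ℕ) (z₀ z₁ : ℂ) : Matrix (Fin 3) (Fin 3) ℂ :=
  !![((((N : ℂ) + 1) / 2) * z₀ + alphaN N ^ 2 * z₁ ^ 2) / sqN N, -(alphaN N) * z₁,
       (z₀ - alphaN N * z₁ ^ 2) / sqN N;
     -(alphaN N) * z₁, alphaN N, z₁;
     (z₀ - alphaN N * z₁ ^ 2) / sqN N, z₁, (2 * z₀ + z₁ ^ 2) / sqN N]

/-- The distinguished eigenvector `E = (−α, 0, 1)ᵀ`. -/
def Evec (N : ℕ) : Fin 3 → ℂ := ![-(alphaN N), 0, 1]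

lemma sqN_sq (N : ℕ) : sqN N ^ 2 = -(N : ℂ) := by
  have h : ((Real.sqrt N : ℝ) : ℂ) ^ 2 = (N : ℂ) := by
    rw [← Complex.ofReal_pow, Real.sq_sqrt N.cast_nonneg, Complex.ofReal_natCast]
  rw [sqN, mul_pow, Complex.I_sq, h, neg_one_mul]

/-- The decomposition `g = X + αY`, entrywise. -/
lemma Xof_add_alphaN_mul_Yof {N : ℕ} (hN : N ≠ 0) (g : Matrix (Fin 3) (Fin 3) ℂ)
    (i j : Fin 3) :
    (Xof N g i j : ℂ) + alphaN N * (Yof N g i j : ℂ) = g i j := by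
  have h : ((Real.sqrt N : ℝ) : ℂ) ≠ 0 := by
    rw [Complex.ofReal_ne_zero, Real.sqrt_ne_zero N.cast_nonneg]
    exact_mod_cast hN
  simp only [Xof, Yof, alphaN, sqN, Matrix.add_apply, Matrix.smul_apply, Matrix.map_apply,
    smul_eq_mul]
  push_cast
  conv_rhs => rw [← Complex.re_add_im (g i j)]
  field_simp
  ring

lemma twistT_inv : twistT⁻¹ =
    Matrix.fromBlocks !![1, 0, 0; 0, 1, 0; 0, 0, 0] !![0, 0, 0; 0, 0, 0; 0, 0, 1]
      !![0, 0, 0; 0, 0, 0; 0, 0, -1] !![1, 0, 0; 0, 1, 0; 0, 0, 0] := by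
  apply Matrix.inv_eq_right_inv
  rw [twistT, Matrix.fromBlocks_multiply, ← Matrix.fromBlocks_one]
  congr 1 <;> ext i j <;> fin_cases i <;> fin_cases j <;> simp

/-- The eigenvector identity `(CΩ + D)ᵀ·E = (g₃₁z₀ + g₃₂z₁ + g₃₃)·E` for the twisted
embedding: the line spanned by `E` is invariant, so the relative tangent bundle of the
family of abelian three-folds over `𝕃₂` splits off a line bundle. -/
theorem statement13
    (N : ℕ) (hN : N % 4 = 3)
    (z₀ z₁ : ℂ) (hz : InL2 z₀ z₁)
    (g : Matrix (Fin 3) (Fin 3) ℂ) (hg : gᴴ * H3c * g = H3c) :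
    (((iota N g).toBlocks₂₁.map (Complex.ofReal) * iotaStar N z₀ z₁
        + (iota N g).toBlocks₂₂.map (Complex.ofReal))ᵀ).mulVec (Evec N)
      = (g 2 0 * z₀ + g 2 1 * z₁ + g 2 2) • Evec N := by
  have hN0 : N ≠ 0 := by rintro rfl; simp at hN
  have hs : sqN N ≠ 0 := fun h => hN0 <| by
    have := sqN_sq N
    rw [h] at this
    simpa using this
  have hn : (N : ℂ) = -sqN N ^ 2 := by rw [sqN_sq, neg_neg]
  simp only [← Xof_add_alphaN_mul_Yof hN0 g]
  ext i
  rw [iota, twistT_inv, twistT, rho]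
  simp only [Matrix.fromBlocks_multiply, Matrix.toBlocks_fromBlocks₂₁,
    Matrix.toBlocks_fromBlocks₂₂, iotaStar, Evec, H3r, alphaN]
  generalize Xof N g = X
  generalize Yof N g = Y
  generalize sqN N = s at *
  fin_cases i <;>
  · simp [Matrix.mulVec, dotProduct, Matrix.mul_apply, Fin.sum_univ_three, hn, -Matrix.cons_mul]
    field_simp
    ring
end
end
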